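/- Let F be a field and R = F[a,b,c,d,e,f,g,h,i,j,k,l] (a polynomial ring in 12 variables). Then the ideal I = (ae−bd, af−cd, bf−ce, gk−hj, gl−ij, hl−ik, ag+bh+ci, dg+eh+fi, aj+bk+cl, dj+ek+fl) has height 5, and every generating set of I has at least 10 elements. -/

import Mathlib

/-- The height of a prime ideal `P`: the supremum of the lengths of strictly increasing
chains of prime ideals ending at `P` (i.e. of strictly descending chains below `P`). -/
noncomputable def primeHt {R : Type*} [CommRing R] (P : Ideal R) : ℕ∞ :=
  ⨆ (k : ℕ) (_ : ∃ c : Fin (k + 1) → Ideal R, StrictMono c ∧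
    (∀ i, (c i).IsPrime) ∧ c (Fin.last k) = P), (k : ℕ∞)

/-- The height of an ideal `I`: the infimum of the heights of the primes containing it. -/
noncomputable def idealHt {R : Type*} [CommRing R] (I : Ideal R) : ℕ∞ :=
  ⨅ (P : Ideal R) (_ : P.IsPrime) (_ : I ≤ P), primeHt P

theorem primeHt_eq_height {R : Type*} [CommRing R] (P : Ideal R) [hP : P.IsPrime] :
    primeHt P = P.height := by
  rw [show P.height = Order.height (⟨P, hP⟩ : PrimeSpectrum R) from
    PrimeSpectrum.height_eq_orderHeight ⟨P, hP⟩]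
  apply le_antisymm
  · refine iSup₂_le fun k hk ↦ ?_
    obtain ⟨c, hc, hprime, hlast⟩ := hk
    let p : LTSeries (PrimeSpectrum R) :=
      ⟨k, fun i ↦ ⟨c i, hprime i⟩, fun i ↦ hc i.castSucc_lt_succ⟩
    have hp : p.last = ⟨P, hP⟩ := PrimeSpectrum.ext hlast
    exact hp ▸ Order.length_le_height_last
  · refine ENat.forall_natCast_le_iff_le.mp fun n hn ↦ ?_
    obtain ⟨p, hlast, rfl⟩ := Order.exists_series_of_le_height _ hn
    exact le_iSup₂_of_le p.length ⟨fun i ↦ (p i).asIdeal, fun i j hij ↦ p.strictMono hij,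
      fun i ↦ (p i).isPrime, congrArg PrimeSpectrum.asIdeal hlast⟩ le_rfl

namespace MvPolynomial

section HeightOfSubstitution

variable {σ F : Type*} [Field F]

/-- The substitution `X i ↦ num i / a`, with values in the field of rational functions. -/
noncomputable def ratSubst (a : MvPolynomial σ F) (num : σ → MvPolynomial σ F) :
    MvPolynomial σ F →ₐ[F] FractionRing (MvPolynomial σ F) :=
  aeval fun i ↦ algebraMap _ _ (num i) / algebraMap _ _ a

instance (a : MvPolynomial σ F) (num : σ → MvPolynomial σ F) :
    (RingHom.ker (ratSubst a num)).IsPrime :=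
  RingHom.ker_isPrime _

theorem ker_ratSubst_le {P : Ideal (MvPolynomial σ F)} [P.IsPrime] {a : MvPolynomial σ F}
    {num : σ → MvPolynomial σ F} (ha : a ∉ P) (h : ∀ i, a * X i - num i ∈ P) :
    RingHom.ker (ratSubst a num) ≤ P := by
  have ha0 : algebraMap _ (FractionRing (MvPolynomial σ F)) a ≠ 0 := by
    simpa using fun h0 : a = 0 ↦ ha (h0 ▸ P.zero_mem)
  have key : ∀ x : MvPolynomial σ F, ∃ (n : ℕ) (y : MvPolynomial σ F), a ^ n * x - y ∈ P ∧
      algebraMap _ _ a ^ n * ratSubst a num x = algebraMap _ _ y := by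
    intro x
    induction x using MvPolynomial.induction_on with
    | C r =>
      refine ⟨0, C r, by simp, ?_⟩
      rw [← algebraMap_eq, AlgHom.commutes, ← IsScalarTower.algebraMap_apply]
      simp
    | add p q hp hq =>
      obtain ⟨m, y, hy, hy'⟩ := hp
      obtain ⟨n, z, hz, hz'⟩ := hq
      refine ⟨m + n, a ^ n * y + a ^ m * z, ?_, ?_⟩
      · convert P.add_mem (P.mul_mem_left (a ^ n) hy) (P.mul_mem_left (a ^ m) hz) using 1
        ring
      · simp only [map_add, map_mul, map_pow, ← hy', ← hz']
        ring
    | mul_X p i hp =>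
      obtain ⟨m, y, hy, hy'⟩ := hp
      refine ⟨m + 1, y * num i, ?_, ?_⟩
      · convert P.add_mem (P.mul_mem_left (a * X i) hy) (P.mul_mem_left y (h i)) using 1
        ring
      · have hX : ratSubst a num (X i) = algebraMap _ _ (num i) / algebraMap _ _ a :=
          aeval_X _ _
        rw [map_mul, map_mul, ← hy', hX]
        field_simp
        ring
  intro x hx
  obtain ⟨n, y, hy, hy'⟩ := key x
  rw [RingHom.mem_ker.mp hx, mul_zero, eq_comm, FaithfulSMul.algebraMap_eq_zero_iff] at hy'
  rw [hy', sub_zero] at hy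
  exact (Ideal.IsPrime.mem_or_mem ‹_› hy).resolve_left fun h' ↦
    ha (Ideal.IsPrime.mem_of_pow_mem ‹_› n h')

/-- `p` does not involve the variables in `s`. -/
def FreeOf (s : Finset σ) (p : MvPolynomial σ F) : Prop :=
  ∀ v : σ → FractionRing (MvPolynomial σ F), (∀ j ∉ s, v j = algebraMap (MvPolynomial σ F) _ (X j)) →
    aeval v p = algebraMap _ _ p

variable [DecidableEq σ]

/-- The numerators of the substitution `X i ↦ num i / a` for `i ∈ s`, `X i ↦ X i` for `i ∉ s`. -/
noncomputable def partialNum (s : Finset σ) (a : MvPolynomial σ F) (num : σ → MvPolynomial σ F)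
    (i : σ) : MvPolynomial σ F :=
  if i ∈ s then num i else a * X i

theorem ratSubst_partialNum_of_freeOf {s t : Finset σ} (hts : t ⊆ s) {a p : MvPolynomial σ F}
    (ha : a ≠ 0) (num : σ → MvPolynomial σ F) (hp : FreeOf s p) :
    ratSubst a (partialNum t a num) p = algebraMap _ _ p := by
  refine hp _ fun j hj ↦ ?_
  have : algebraMap _ (FractionRing (MvPolynomial σ F)) a ≠ 0 := by simpa using ha
  rw [partialNum, if_neg fun h ↦ hj (hts h), map_mul]
  field_simp

theorem ratSubst_partialNum_X {t : Finset σ} {i : σ} (hi : i ∉ t) {a : MvPolynomial σ F}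
    (ha : a ≠ 0) (num : σ → MvPolynomial σ F) :
    ratSubst a (partialNum t a num) (X i) = algebraMap (MvPolynomial σ F) _ (X i) := by
  have : algebraMap _ (FractionRing (MvPolynomial σ F)) a ≠ 0 := by simpa using ha
  rw [ratSubst, aeval_X, partialNum, if_neg hi, map_mul]
  field_simp

theorem card_le_height_ker_ratSubst {s : Finset σ} {a : MvPolynomial σ F}
    {num : σ → MvPolynomial σ F} (ha : a ≠ 0) (hfa : FreeOf s a)
    (hfn : ∀ i ∈ s, FreeOf s (num i)) :
    (s.card : ℕ∞) ≤ (RingHom.ker (ratSubst a (partialNum s a num))).height := by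
  have ha' : algebraMap _ (FractionRing (MvPolynomial σ F)) a ≠ 0 := by simpa using ha
  suffices ∀ t ⊆ s, (t.card : ℕ∞) ≤ (RingHom.ker (ratSubst a (partialNum t a num))).height from
    this s subset_rfl
  intro t
  induction t using Finset.induction_on with
  | empty => simp
  | insert i t hi ih =>
    intro hs
    have hts : t ⊆ s := (Finset.subset_insert i t).trans hs
    have his : i ∈ s := hs (Finset.mem_insert_self i t)
    have hmem : ∀ j ∈ insert i t,
        a * X j - num j ∈ RingHom.ker (ratSubst a (partialNum (insert i t) a num)) := by
      intro j hj
      rw [RingHom.mem_ker, map_sub, map_mul, ratSubst_partialNum_of_freeOf hs ha num hfa,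
        ratSubst_partialNum_of_freeOf hs ha num (hfn j (hs hj)), ratSubst, aeval_X, partialNum,
        if_pos hj]
      field_simp
      simp
    have hle : RingHom.ker (ratSubst a (partialNum t a num)) ≤
        RingHom.ker (ratSubst a (partialNum (insert i t) a num)) := by
      refine ker_ratSubst_le ?_ fun j ↦ ?_
      · rwa [RingHom.mem_ker, ratSubst_partialNum_of_freeOf hs ha num hfa]
      · by_cases hj : j ∈ t
        · rw [partialNum, if_pos hj]
          exact hmem j (Finset.mem_insert_of_mem hj)
        · simp [partialNum, hj]
    have hlt : RingHom.ker (ratSubst a (partialNum t a num)) <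
        RingHom.ker (ratSubst a (partialNum (insert i t) a num)) := by
      refine lt_of_le_not_ge hle fun hge ↦ ha ?_
      have h1 := hge (hmem i (Finset.mem_insert_self i t))
      rw [RingHom.mem_ker, map_sub, map_mul, ratSubst_partialNum_of_freeOf hts ha num hfa,
        ratSubst_partialNum_of_freeOf hts ha num (hfn i his), ratSubst_partialNum_X hi ha num,
        sub_eq_zero, ← map_mul, (FaithfulSMul.algebraMap_injective _ _).eq_iff] at h1
      have h2 := hfn i his (Function.update (fun j ↦ algebraMap (MvPolynomial σ F) _ (X j)) i 0) fun j hj ↦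
        Function.update_of_ne (ne_of_mem_of_not_mem his hj).symm _ _
      rw [← h1] at h2
      simpa using h2.symm
    rw [Finset.card_insert_of_notMem hi, Nat.cast_add, Nat.cast_one]
    exact (add_le_add_left (ih hts) 1).trans (Ideal.height_add_one_le_of_lt_of_isPrime hlt)

theorem card_le_height_of_X_mem {P : Ideal (MvPolynomial σ F)} [P.IsPrime] {s : Finset σ}
    (h : ∀ i ∈ s, X i ∈ P) : (s.card : ℕ∞) ≤ P.height := by
  refine (card_le_height_ker_ratSubst (a := 1) (num := 0) one_ne_zero (fun v _ ↦ by simp)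
    fun i _ v _ ↦ by simp).trans (Ideal.height_mono (ker_ratSubst_le ?_ fun i ↦ ?_))
  · exact (Ideal.ne_top_iff_one P).mp (Ideal.IsPrime.ne_top ‹_›)
  · by_cases hi : i ∈ s <;> simp [partialNum, hi, h]

end HeightOfSubstitution

section NumberOfGenerators

variable {σ F : Type*} [Field F]

theorem coeff_mul_of_isHomogeneous {n : ℕ} {q : MvPolynomial σ F} (hq : q.IsHomogeneous n)
    {m : σ →₀ ℕ} (hm : m.degree = n) (r : MvPolynomial σ F) :
    coeff m (r * q) = coeff 0 r * coeff m q := by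
  classical
  induction r using MvPolynomial.induction_on' with
  | add r r' h h' => rw [add_mul, coeff_add, h, h', coeff_add, add_mul]
  | monomial u c =>
    rw [coeff_monomial_mul', coeff_monomial]
    by_cases hu : u = 0
    · simp [hu]
    · rw [if_neg hu, zero_mul]
      split_ifs with hum
      · have hdeg : (m - u).degree ≠ n := by
          have h1 : u.degree + (m - u).degree = n := by
            rw [← map_add, add_tsub_cancel_of_le hum, hm]
          have h2 : u.degree ≠ 0 := by
            rwa [ne_eq, Finsupp.degree_eq_zero_iff]
          lia
        rw [hq.coeff_eq_zero hdeg, mul_zero]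
      · rfl

/-- If `q` is a family of forms of degree `n` with a dual family of monomials of degree `n`,
then the ideal generated by `q` has no smaller generating family. -/
theorem card_le_card_of_span_eq {ι κ : Type*} [Fintype ι] [DecidableEq ι] [Fintype κ] {n : ℕ}
    {q : ι → MvPolynomial σ F} (hq : ∀ i, (q i).IsHomogeneous n) {m : ι → σ →₀ ℕ}
    (hm : ∀ i, (m i).degree = n) (hqm : ∀ i j, coeff (m i) (q j) = if i = j then 1 else 0)
    {g : κ → MvPolynomial σ F} (hg : Ideal.span (Set.range g) = Ideal.span (Set.range q)) :
    Fintype.card ι ≤ Fintype.card κ := by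
  have hmul : ∀ x ∈ Ideal.span (Set.range q), ∀ (r : MvPolynomial σ F) (i : ι),
      coeff (m i) (r * x) = coeff 0 r * coeff (m i) x := by
    intro x hx
    induction hx using Submodule.span_induction with
    | mem x hx =>
      obtain ⟨j, rfl⟩ := hx
      exact fun r i ↦ coeff_mul_of_isHomogeneous (hq j) (hm i) r
    | zero => simp
    | add x y _ _ hx hy =>
      intro r i
      rw [mul_add, coeff_add, hx, hy, coeff_add, mul_add]
    | smul s x _ hx =>
      intro r i
      rw [smul_eq_mul, ← mul_assoc, hx, hx, ← constantCoeff_eq, map_mul, mul_assoc]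
  let Φ : MvPolynomial σ F →ₗ[F] ι → F := LinearMap.pi fun i ↦ lcoeff F (m i)
  have hΦ : ∀ x ∈ Ideal.span (Set.range g), Φ x ∈ Submodule.span F (Set.range (Φ ∘ g)) := by
    intro x hx
    induction hx using Submodule.span_induction with
    | mem x hx =>
      obtain ⟨j, rfl⟩ := hx
      exact Submodule.subset_span ⟨j, rfl⟩
    | zero => simp
    | add x y _ _ hx hy => rw [map_add]; exact Submodule.add_mem _ hx hy
    | smul s x hx' hx =>
      have : Φ (s • x) = coeff 0 s • Φ x := by
        funext i
        exact hmul x (hg ▸ hx') s i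
      rw [this]
      exact Submodule.smul_mem _ _ hx
  have htop : Submodule.span F (Set.range (Φ ∘ g)) = ⊤ := by
    rw [eq_top_iff, ← (Pi.basisFun F ι).span_eq, Submodule.span_le]
    rintro _ ⟨j, rfl⟩
    convert! hΦ (q j) (hg ▸ Ideal.subset_span ⟨j, rfl⟩) using 1
    funext i
    simp [Φ, hqm, Pi.single_apply]
  have := finrank_range_le_card (R := F) (Φ ∘ g)
  rwa [Set.finrank, htop, finrank_top, Module.finrank_pi] at this

theorem coeff_single_add_single_X_mul_X [DecidableEq σ] (i j k l : σ) :
    coeff (Finsupp.single i 1 + Finsupp.single j 1) (X k * X l : MvPolynomial σ F) =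
      if (i = k ∧ j = l) ∨ (i = l ∧ j = k) then 1 else 0 := by
  have : (X k * X l : MvPolynomial σ F) =
      monomial (Finsupp.single k 1 + Finsupp.single l 1) 1 := by
    rw [X, X, monomial_mul, one_mul]
  rw [this, coeff_monomial]
  refine if_congr ?_ rfl rfl
  constructor
  · intro h
    have hi := DFunLike.congr_fun h i
    have hj := DFunLike.congr_fun h j
    have hk := DFunLike.congr_fun h k
    simp only [Finsupp.add_apply, Finsupp.single_apply] at hi hj hk
    grind
  · rintro (⟨rfl, rfl⟩ | ⟨rfl, rfl⟩)
    · rfl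
    · exact add_comm _ _

end NumberOfGenerators

end MvPolynomial

section IntervalIdeal

open MvPolynomial

variable {F : Type*} [Field F]

/-- The ten quadrics expressing that the rows of the two `2 × 3` matrices are proportional and
that the two row spaces are orthogonal. -/
noncomputable def intervalQuadric (F : Type*) [Field F] : Fin 10 → MvPolynomial (Fin 12) F :=
  ![X 0 * X 4 - X 1 * X 3, X 0 * X 5 - X 2 * X 3, X 1 * X 5 - X 2 * X 4,
    X 6 * X 10 - X 7 * X 9, X 6 * X 11 - X 8 * X 9, X 7 * X 11 - X 8 * X 10,
    X 0 * X 6 + X 1 * X 7 + X 2 * X 8, X 3 * X 6 + X 4 * X 7 + X 5 * X 8,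
    X 0 * X 9 + X 1 * X 10 + X 2 * X 11, X 3 * X 9 + X 4 * X 10 + X 5 * X 11]

theorem five_le_height_of_X_zero_notMem {P : Ideal (MvPolynomial (Fin 12) F)} [P.IsPrime]
    (h0 : X 0 ∉ P) (he : X 0 * X 4 - X 1 * X 3 ∈ P) (hf : X 0 * X 5 - X 2 * X 3 ∈ P)
    (hg : X 0 * X 6 + X 1 * X 7 + X 2 * X 8 ∈ P)
    (hj : X 0 * X 9 + X 1 * X 10 + X 2 * X 11 ∈ P)
    (hl : X 7 * X 11 - X 8 * X 10 ∈ P) : 5 ≤ P.height := by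
  let s : Finset (Fin 12) := {4, 5, 6, 9}
  let num : Fin 12 → MvPolynomial (Fin 12) F := fun i ↦
    if i = 4 then X 1 * X 3 else if i = 5 then X 2 * X 3
    else if i = 6 then -(X 1 * X 7 + X 2 * X 8)
    else if i = 9 then -(X 1 * X 10 + X 2 * X 11) else 0
  have hfa : FreeOf s (X 0 : MvPolynomial (Fin 12) F) := fun v hv ↦ by simp [hv, s]
  have hfn : ∀ i ∈ s, FreeOf s (num i) := by
    intro i _ v hv
    simp only [num]
    split_ifs <;> simp [hv, s]
  have hcard := card_le_height_ker_ratSubst (X_ne_zero 0) hfa hfn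
  have hle : RingHom.ker (ratSubst (X 0) (partialNum s (X 0) num)) ≤ P := by
    refine ker_ratSubst_le h0 fun i ↦ ?_
    by_cases hi : i ∈ s
    · rw [partialNum, if_pos hi]
      simp only [s, Finset.mem_insert, Finset.mem_singleton] at hi
      rcases hi with rfl | rfl | rfl | rfl
      · exact he
      · exact hf
      · rwa [add_assoc, ← sub_neg_eq_add] at hg
      · rwa [add_assoc, ← sub_neg_eq_add] at hj
    · simp [partialNum, hi]
  have hlt : RingHom.ker (ratSubst (X 0) (partialNum s (X 0) num)) < P := by
    refine lt_of_le_not_ge hle fun hge ↦ ?_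
    have h1 := hge hl
    rw [RingHom.mem_ker, ratSubst_partialNum_of_freeOf subset_rfl (X_ne_zero 0) num
      (fun v hv ↦ by simp [hv, s]), FaithfulSMul.algebraMap_eq_zero_iff] at h1
    simpa using congrArg (aeval fun i : Fin 12 ↦ if i = 7 ∨ i = 11 then (1 : F) else 0) h1
  have h5 : (s.card : ℕ∞) + 1 ≤ P.height :=
    (add_le_add_left hcard 1).trans (Ideal.height_add_one_le_of_lt_of_isPrime hlt)
  exact h5

theorem five_le_height_of_X_notMem {P : Ideal (MvPolynomial (Fin 12) F)} [P.IsPrime]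
    {a b c d e f g h i j k l : Fin 12}
    (hinj : Function.Injective ![a, b, c, d, e, f, g, h, i, j, k, l])
    (h0 : X a ∉ P) (he : X a * X e - X b * X d ∈ P) (hf : X a * X f - X c * X d ∈ P)
    (hg : X a * X g + X b * X h + X c * X i ∈ P)
    (hj : X a * X j + X b * X k + X c * X l ∈ P)
    (hl : X h * X l - X i * X k ∈ P) : 5 ≤ P.height := by
  let φ : MvPolynomial (Fin 12) F ≃+* MvPolynomial (Fin 12) F :=
    (renameEquiv F (Equiv.ofBijective _ (Finite.injective_iff_bijective.mp hinj))).toRingEquiv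
  have hφ : ∀ n, φ (X n) = X (![a, b, c, d, e, f, g, h, i, j, k, l] n) :=
    fun n ↦ rename_X _ _
  have : (P.comap φ).IsPrime := Ideal.comap_isPrime _ _
  rw [← RingEquiv.height_comap φ P]
  apply five_le_height_of_X_zero_notMem <;> rw [Ideal.mem_comap] <;>
    simp only [map_add, map_sub, map_mul, hφ]
  exacts [h0, he, hf, hg, hj, hl]

theorem five_le_height_of_intervalQuadric_mem {P : Ideal (MvPolynomial (Fin 12) F)} [P.IsPrime]
    (hP : ∀ n, intervalQuadric F n ∈ P) : 5 ≤ P.height := by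
  have h0 : X 0 * X 4 - X 1 * X 3 ∈ P := hP 0
  have h1 : X 0 * X 5 - X 2 * X 3 ∈ P := hP 1
  have h2 : X 1 * X 5 - X 2 * X 4 ∈ P := hP 2
  have h3 : X 6 * X 10 - X 7 * X 9 ∈ P := hP 3
  have h4 : X 6 * X 11 - X 8 * X 9 ∈ P := hP 4
  have h5 : X 7 * X 11 - X 8 * X 10 ∈ P := hP 5
  have h6 : X 0 * X 6 + X 1 * X 7 + X 2 * X 8 ∈ P := hP 6
  have h7 : X 3 * X 6 + X 4 * X 7 + X 5 * X 8 ∈ P := hP 7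
  have h8 : X 0 * X 9 + X 1 * X 10 + X 2 * X 11 ∈ P := hP 8
  have h9 : X 3 * X 9 + X 4 * X 10 + X 5 * X 11 ∈ P := hP 9
  by_contra hlt
  have hX0 : X 0 ∈ P := by
    contrapose! hlt
    exact five_le_height_of_X_zero_notMem hlt h0 h1 h6 h8 h5
  have hX1 : X 1 ∈ P := by
    contrapose! hlt
    refine five_le_height_of_X_notMem (a := 1) (b := 0) (c := 2) (d := 4) (e := 3) (f := 5)
      (g := 7) (h := 6) (i := 8) (j := 10) (k := 9) (l := 11) (by decide) hlt ?_ h2 ?_ ?_ h4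
    · convert P.neg_mem h0 using 1; ring
    · convert h6 using 1; ring
    · convert h8 using 1; ring
  have hX2 : X 2 ∈ P := by
    contrapose! hlt
    refine five_le_height_of_X_notMem (a := 2) (b := 1) (c := 0) (d := 5) (e := 4) (f := 3)
      (g := 8) (h := 7) (i := 6) (j := 11) (k := 10) (l := 9) (by decide) hlt ?_ ?_ ?_ ?_ ?_
    · convert P.neg_mem h2 using 1; ring
    · convert P.neg_mem h1 using 1; ring
    · convert h6 using 1; ring
    · convert h8 using 1; ring
    · convert P.neg_mem h3 using 1; ring
  have hX3 : X 3 ∈ P := by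
    contrapose! hlt
    refine five_le_height_of_X_notMem (a := 3) (b := 4) (c := 5) (d := 0) (e := 1) (f := 2)
      (g := 6) (h := 7) (i := 8) (j := 9) (k := 10) (l := 11) (by decide) hlt ?_ ?_ h7 h9 h5
    · convert P.neg_mem h0 using 1; ring
    · convert P.neg_mem h1 using 1; ring
  have hX4 : X 4 ∈ P := by
    contrapose! hlt
    refine five_le_height_of_X_notMem (a := 4) (b := 3) (c := 5) (d := 1) (e := 0) (f := 2)
      (g := 7) (h := 6) (i := 8) (j := 10) (k := 9) (l := 11) (by decide) hlt ?_ ?_ ?_ ?_ h4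
    · convert h0 using 1; ring
    · convert P.neg_mem h2 using 1; ring
    · convert h7 using 1; ring
    · convert h9 using 1; ring
  exact hlt (card_le_height_of_X_mem (s := {0, 1, 2, 3, 4})
    (by simp [hX0, hX1, hX2, hX3, hX4]))

/-- The generic point of the main component: its ideal contains the ten quadrics and is minimal
over five of them. -/
theorem exists_isPrime_intervalQuadric_mem_height_le (F : Type*) [Field F] :
    ∃ P : Ideal (MvPolynomial (Fin 12) F), P.IsPrime ∧ (∀ n, intervalQuadric F n ∈ P) ∧
      P.height ≤ 5 := by
  let num : Fin 12 → MvPolynomial (Fin 12) F := fun i ↦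
    if i = 4 then X 7 * X 1 * X 3 else if i = 5 then X 7 * X 2 * X 3
    else if i = 6 then -(X 7 * (X 1 * X 7 + X 2 * X 8))
    else if i = 9 then -(X 1 * X 7 * X 10 + X 2 * X 8 * X 10)
    else if i = 11 then X 0 * X 8 * X 10 else X 0 * X 7 * X i
  let ψ := ratSubst (X 0 * X 7) num
  have hne : ∀ i, algebraMap (MvPolynomial (Fin 12) F)
      (FractionRing (MvPolynomial (Fin 12) F)) (X i) ≠ 0 := by simp
  have hψ : ∀ i, ψ (X i) = algebraMap _ _ (num i) /
      algebraMap (MvPolynomial (Fin 12) F) _ (X 0 * X 7) :=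
    fun i ↦ aeval_X _ _
  have hmem : ∀ n, intervalQuadric F n ∈ RingHom.ker ψ := by
    intro n
    rw [RingHom.mem_ker]
    have := hne 0
    have := hne 7
    fin_cases n <;> simp [intervalQuadric, hψ, num] <;> field_simp <;> ring
  have hnotMem : X 0 * X 7 ∉ RingHom.ker ψ := by
    rw [RingHom.mem_ker, map_mul]
    simp [hψ, num]
  refine ⟨RingHom.ker ψ, inferInstance, hmem, ?_⟩
  let J : Finset (Fin 10) := {0, 1, 5, 6, 8}
  have hmin : RingHom.ker ψ ∈
      (Ideal.span (intervalQuadric F '' (J : Set (Fin 10)))).minimalPrimes := by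
    refine ⟨⟨inferInstance, ?_⟩, ?_⟩
    · rw [Ideal.span_le]
      rintro _ ⟨n, _, rfl⟩
      exact hmem n
    · rintro Q ⟨hQ, hJQ⟩ hQP
      have hq : ∀ n ∈ J, intervalQuadric F n ∈ Q := fun n hn ↦
        hJQ (Ideal.subset_span ⟨n, hn, rfl⟩)
      have h0 : X 0 * X 4 - X 1 * X 3 ∈ Q := hq 0 (by decide)
      have h1 : X 0 * X 5 - X 2 * X 3 ∈ Q := hq 1 (by decide)
      have h5 : X 7 * X 11 - X 8 * X 10 ∈ Q := hq 5 (by decide)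
      have h6 : X 0 * X 6 + X 1 * X 7 + X 2 * X 8 ∈ Q := hq 6 (by decide)
      have h8 : X 0 * X 9 + X 1 * X 10 + X 2 * X 11 ∈ Q := hq 8 (by decide)
      refine ker_ratSubst_le (fun h ↦ hnotMem (hQP h)) fun i ↦ ?_
      simp only [num]
      split_ifs with h h h h h
      · subst h
        convert Q.mul_mem_left (X 7) h0 using 1; ring
      · subst h
        convert Q.mul_mem_left (X 7) h1 using 1; ring
      · subst h
        convert Q.mul_mem_left (X 7) h6 using 1; ring
      · subst h
        convert Q.sub_mem (Q.mul_mem_left (X 7) h8) (Q.mul_mem_left (X 2) h5) using 1; ring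
      · subst h
        convert Q.mul_mem_left (X 0) h5 using 1; ring
      · simp
  refine (Ideal.height_le_card_of_mem_minimalPrimes_span (Set.toFinite _) hmin).trans ?_
  have hcard := Set.ncard_image_le (f := intervalQuadric F) J.finite_toSet
  rw [Set.ncard_coe_finset] at hcard
  exact_mod_cast hcard

theorem isHomogeneous_intervalQuadric (n : Fin 10) : (intervalQuadric F n).IsHomogeneous 2 := by
  have h : ∀ i j : Fin 12, (X i * X j : MvPolynomial (Fin 12) F).IsHomogeneous 2 := fun i j ↦
    (isHomogeneous_X F i).mul (isHomogeneous_X F j)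
  fin_cases n
  iterate 6 exact (h _ _).sub (h _ _)
  all_goals exact ((h _ _).add (h _ _)).add (h _ _)

theorem coeff_intervalQuadric (m n : Fin 10) :
    coeff (Finsupp.single (![0, 0, 1, 6, 6, 7, 0, 3, 0, 3] m : Fin 12) 1 +
      Finsupp.single (![4, 5, 5, 10, 11, 11, 6, 6, 9, 9] m) 1) (intervalQuadric F n) =
      if m = n then 1 else 0 := by
  fin_cases n <;>
    simp only [intervalQuadric, Fin.zero_eta, Fin.mk_one, Fin.reduceFinMk, Matrix.cons_val,
      coeff_sub, coeff_add, coeff_single_add_single_X_mul_X] <;>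
    fin_cases m <;> simp

end IntervalIdeal

open MvPolynomial in
/-- In `R = F[a,…,l]` (with `a,…,l` the variables `X 0,…,X 11`), the ideal
`(ae−bd, af−cd, bf−ce, gk−hj, gl−ij, hl−ik, ag+bh+ci, dg+eh+fi, aj+bk+cl, dj+ek+fl)`
has height `5` and every generating set has at least `10` elements. -/
theorem intervalH_ideal_not_lci (F : Type*) [Field F]
    (I : Ideal (MvPolynomial (Fin 12) F))
    (hI : I = Ideal.span
      {X 0 * X 4 - X 1 * X 3, X 0 * X 5 - X 2 * X 3, X 1 * X 5 - X 2 * X 4,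
        X 6 * X 10 - X 7 * X 9, X 6 * X 11 - X 8 * X 9, X 7 * X 11 - X 8 * X 10,
        X 0 * X 6 + X 1 * X 7 + X 2 * X 8, X 3 * X 6 + X 4 * X 7 + X 5 * X 8,
        X 0 * X 9 + X 1 * X 10 + X 2 * X 11, X 3 * X 9 + X 4 * X 10 + X 5 * X 11}) :
    idealHt I = 5 ∧
      ∀ (k : ℕ) (g : Fin k → MvPolynomial (Fin 12) F),
        Ideal.span (Set.range g) = I → 10 ≤ k := by
  have hrange : I = Ideal.span (Set.range (intervalQuadric F)) := by
    simp only [hI, intervalQuadric, Matrix.range_cons, Matrix.range_empty, Set.insert_eq,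
      Set.union_empty]
  have hle : ∀ P : Ideal (MvPolynomial (Fin 12) F), I ≤ P ↔ ∀ n, intervalQuadric F n ∈ P := by
    intro P
    rw [hrange, Ideal.span_le, Set.range_subset_iff]
    rfl
  refine ⟨le_antisymm ?_ ?_, fun k g hg ↦ ?_⟩
  · obtain ⟨P, hP, hmem, hheight⟩ := exists_isPrime_intervalQuadric_mem_height_le F
    exact (iInf_le_of_le P (iInf₂_le hP ((hle P).mpr hmem))).trans
      ((primeHt_eq_height P).trans_le hheight)
  · refine le_iInf fun P ↦ le_iInf₂ fun hP hIP ↦ ?_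
    rw [primeHt_eq_height]
    exact five_le_height_of_intervalQuadric_mem ((hle P).mp hIP)
  · have hcard := card_le_card_of_span_eq isHomogeneous_intervalQuadric
      (fun m ↦ by rw [map_add, Finsupp.degree_single, Finsupp.degree_single])
      coeff_intervalQuadric (hg.trans hrange)
    rwa [Fintype.card_fin, Fintype.card_fin] at hcard
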